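/- Let an n-job coupled-task instance be given with the jobs indexed so that a_1 + b_1 ≤ a_2 + b_2 ≤ … ≤ a_n + b_n. Then for every feasible schedule σ and every j ∈ {1,…,n}, the j-th smallest completion time among the completion times C_1(σ),…,C_n(σ) is at least ∑_{i=1}^{j} (a_i + b_i); consequently the total completion time of σ satisfies ∑_{j=1}^{n} C_j(σ) ≥ ∑_{j=1}^{n} ∑_{i=1}^{j} (a_i + b_i). -/

import Mathlib

open Finset

/-- The interval occupied by the first task of job `j`. -/
def task1 {n : ℕ} (a S : Fin n → ℝ) (j : Fin n) : Set ℝ := Set.Ico (S j) (S j + a j)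

/-- The interval occupied by the second task of job `j`. -/
def task2 {n : ℕ} (a L b S : Fin n → ℝ) (j : Fin n) : Set ℝ :=
  Set.Ico (S j + a j + L j) (S j + a j + L j + b j)

/-- A schedule `S` for the coupled-task instance `(a, L, b)` is feasible if all start
times are nonnegative and the `2n` task intervals are pairwise disjoint. -/
def Feasible {n : ℕ} (a L b S : Fin n → ℝ) : Prop :=
  (∀ j, 0 ≤ S j) ∧
  (∀ i j, i ≠ j → Disjoint (task1 a S i) (task1 a S j)) ∧
  (∀ i j, i ≠ j → Disjoint (task2 a L b S i) (task2 a L b S j)) ∧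
  (∀ i j, Disjoint (task1 a S i) (task2 a L b S j))

/-- The completion time of job `j` in schedule `S`. -/
def cTime {n : ℕ} (a L b S : Fin n → ℝ) (j : Fin n) : ℝ := S j + a j + L j + b j

open MeasureTheory in
lemma sum_le_of_completed {n : ℕ} (a L b S : Fin n → ℝ)
    (ha : ∀ j, 0 < a j) (hL : ∀ j, 0 ≤ L j) (hb : ∀ j, 0 < b j)
    (hfeas : Feasible a L b S) (T : Finset (Fin n)) (X : ℝ) (hX : 0 ≤ X)
    (hT : ∀ j ∈ T, cTime a L b S j ≤ X) : ∑ i ∈ T, (a i + b i) ≤ X := by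
  obtain ⟨h0, h1, h2, h3⟩ := hfeas
  have hm1 : ∀ j, MeasurableSet (task1 a S j) := fun j => measurableSet_Ico
  have hm2 : ∀ j, MeasurableSet (task2 a L b S j) := fun j => measurableSet_Ico
  have hv : ∀ j, volume (task1 a S j ∪ task2 a L b S j) = ENNReal.ofReal (a j + b j) := by
    intro j
    rw [measure_union (h3 j j) (hm2 j), task1, task2, Real.volume_Ico, Real.volume_Ico,
      ← ENNReal.ofReal_add (by linarith [ha j]) (by linarith [hb j])]
    congr 1
    ring
  have hU : volume (⋃ j ∈ T, (task1 a S j ∪ task2 a L b S j))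
      = ∑ j ∈ T, volume (task1 a S j ∪ task2 a L b S j) := by
    apply measure_biUnion_finset
    · intro i _ j _ hij
      simp only [Function.onFun, Set.disjoint_union_left, Set.disjoint_union_right]
      exact ⟨⟨h1 i j hij, (h3 j i).symm⟩, h3 i j, h2 i j hij⟩
    · intro j _
      exact (hm1 j).union (hm2 j)
  have hsub : (⋃ j ∈ T, (task1 a S j ∪ task2 a L b S j)) ⊆ Set.Ico 0 X := by
    intro x hx
    simp only [Set.mem_iUnion] at hx
    obtain ⟨j, hj, hx⟩ := hx
    have hc := hT j hj
    have := h0 j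
    have := ha j
    have := hb j
    have := hL j
    simp only [cTime] at hc
    simp only [task1, task2, Set.mem_union, Set.mem_Ico] at hx
    rcases hx with ⟨hx, hx'⟩ | ⟨hx, hx'⟩ <;> constructor <;> linarith
  have hle := measure_mono (μ := volume) hsub
  rw [hU, Finset.sum_congr rfl (fun j _ => hv j), Real.volume_Ico,
    ← ENNReal.ofReal_sum_of_nonneg (fun j _ => (add_pos (ha j) (hb j)).le), sub_zero] at hle
  exact (ENNReal.ofReal_le_ofReal_iff hX).1 hle

lemma sum_Iic_le_perm {n : ℕ} (f : Fin n → ℝ) (hf : Monotone f) (σ : Equiv.Perm (Fin n))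
    (j : Fin n) : ∑ i ∈ Finset.Iic j, f i ≤ ∑ i ∈ Finset.Iic j, f (σ i) := by
  have e1 : ∑ i ∈ Finset.Iic j, (f i - f j) = ∑ i, min (f i - f j) 0 := by
    rw [← Finset.sum_subset (Finset.subset_univ (Finset.Iic j))]
    · apply Finset.sum_congr rfl
      intro i hi
      rw [min_eq_left (sub_nonpos.2 (hf (Finset.mem_Iic.1 hi)))]
    · intro i _ hi
      rw [Finset.mem_Iic, not_le] at hi
      exact min_eq_right (sub_nonneg.2 (hf hi.le))
  have e2 : ∑ i, min (f i - f j) 0 = ∑ i, min (f (σ i) - f j) 0 :=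
    (Equiv.sum_comp σ (fun i => min (f i - f j) 0)).symm
  have e3 : ∑ i, min (f (σ i) - f j) 0 ≤ ∑ i ∈ Finset.Iic j, min (f (σ i) - f j) 0 := by
    rw [← Finset.sum_add_sum_compl (Finset.Iic j)]
    have : ∑ i ∈ (Finset.Iic j)ᶜ, min (f (σ i) - f j) 0 ≤ 0 :=
      Finset.sum_nonpos (fun i _ => min_le_right _ _)
    linarith
  have e4 : ∑ i ∈ Finset.Iic j, min (f (σ i) - f j) 0 ≤ ∑ i ∈ Finset.Iic j, (f (σ i) - f j) :=
    Finset.sum_le_sum (fun i _ => min_le_left _ _)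
  rw [Finset.sum_sub_distrib] at e1 e4
  linarith

/-- If the jobs are indexed in nondecreasing `a + b` order, then in any feasible schedule the
`j`-th smallest completion time (given by sorting the completion times) is at least
`∑_{i ≤ j} (a i + b i)`; consequently the total completion time is at least
`∑ j, ∑_{i ≤ j} (a i + b i)`. -/
theorem jth_smallest_completion_lower_bound (n : ℕ) (a L b S : Fin n → ℝ)
    (ha : ∀ j, 0 < a j) (hL : ∀ j, 0 ≤ L j) (hb : ∀ j, 0 < b j)
    (hsorted : Monotone fun j => a j + b j)
    (hfeas : Feasible a L b S) :
    (∀ j : Fin n, ∑ i ∈ Finset.Iic j, (a i + b i) ≤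
      cTime a L b S (Tuple.sort (cTime a L b S) j)) ∧
    ∑ j : Fin n, ∑ i ∈ Finset.Iic j, (a i + b i) ≤ ∑ j : Fin n, cTime a L b S j := by
  have key : ∀ j : Fin n, ∑ i ∈ Finset.Iic j, (a i + b i) ≤
      cTime a L b S (Tuple.sort (cTime a L b S) j) := by
    intro j
    refine (sum_Iic_le_perm _ hsorted (Tuple.sort (cTime a L b S)) j).trans ?_
    have h := sum_le_of_completed a L b S ha hL hb hfeas
      ((Finset.Iic j).map (Tuple.sort (cTime a L b S)).toEmbedding)
      (cTime a L b S (Tuple.sort (cTime a L b S) j)) ?_ ?_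
    · rwa [Finset.sum_map] at h
    · generalize Tuple.sort (cTime a L b S) j = k
      have := hfeas.1 k
      have := ha k
      have := hb k
      have := hL k
      simp only [cTime]
      linarith
    · intro k hk
      rw [Finset.mem_map] at hk
      obtain ⟨i, hi, rfl⟩ := hk
      exact Tuple.monotone_sort (cTime a L b S) (Finset.mem_Iic.1 hi)
  refine ⟨key, ?_⟩
  rw [← Equiv.sum_comp (Tuple.sort (cTime a L b S)) (cTime a L b S)]
  exact Finset.sum_le_sum (fun j _ => key j)
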